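/- Let R be an integral domain that is not a field and let * be a star operation on R that is spectral and of finite type (i.e. * is of finite type and (I ∩ J)^* = I^* ∩ J^* for all fractional ideals I, J). If R is Clifford *-regular, then * equals the w-operation: I^* = I^w for every fractional ideal I of R. -/

import Mathlib

open scoped Pointwise

section Defs

variable (A K : Type*) [CommRing A] [Field K] [Algebra A K]

/-- `I` is a nonzero fractional ideal of `A` (inside `K`):
`I ≠ 0` and `dI ⊆ A` for some nonzero `d ∈ A`. -/
def IsFrac (I : Submodule A K) : Prop :=
  I ≠ ⊥ ∧ ∃ d : A, d ≠ 0 ∧ ∀ x ∈ I, ∃ a : A, algebraMap A K d * x = algebraMap A K a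

/-- The divisorial closure `I^v = (A : (A : I))`; here `(J : I) = J / I` and
`(1 : Submodule A K)` is the image of `A` in `K`. -/
def vS (I : Submodule A K) : Submodule A K := 1 / (1 / I)

/-- The `t`-operation `I^t = ⋃ {J^v : J ⊆ I nonzero finitely generated}` (a directed union,
hence equal to the supremum of submodules). -/
def tS (I : Submodule A K) : Submodule A K :=
  ⨆ J ∈ {J : Submodule A K | J ≠ ⊥ ∧ J.FG ∧ J ≤ I}, vS A K J

/-- The image of an integral ideal of `A` in `K`. -/
def idealK (I : Ideal A) : Submodule A K := Submodule.map (Algebra.linearMap A K) I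

/-- A nonzero (fractional) ideal `I` is stable if `I((I:I):I) = (I:I)`. -/
def IsStableIdeal (I : Submodule A K) : Prop := I * ((I / I) / I) = I / I

/-- `A` is a stable domain: every nonzero (fractional) ideal is stable. -/
def StableDomain : Prop := ∀ I : Submodule A K, IsFrac A K I → IsStableIdeal A K I

/-- `A` is Clifford regular: every nonzero (fractional) ideal `I` satisfies `I = I²J`
for some nonzero `A`-submodule `J` of `K`. -/
def CliffordRegularDomain : Prop :=
  ∀ I : Submodule A K, IsFrac A K I → ∃ J : Submodule A K, J ≠ ⊥ ∧ I = I * I * J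

end Defs
section Star

variable (R K : Type*) [CommRing R] [IsDomain R] [Field K] [Algebra R K] [IsFractionRing R K]

/-- A star operation on the domain `R` with quotient field `K`: a map on (nonzero)
fractional ideals satisfying `(aI)^* = aI^*`, `R^* = R`, `I ⊆ I^*`, monotonicity and
idempotency. -/
structure StarOperation : Type _ where
  star : Submodule R K → Submodule R K
  star_frac : ∀ I, IsFrac R K I → IsFrac R K (star I)
  star_smul : ∀ (a : K), a ≠ 0 → ∀ I, IsFrac R K I → star (a • I) = a • star I
  star_one : star (1 : Submodule R K) = 1
  le_star : ∀ I, IsFrac R K I → I ≤ star I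
  star_mono : ∀ I J, IsFrac R K I → IsFrac R K J → I ≤ J → star I ≤ star J
  star_star : ∀ I, IsFrac R K I → star (star I) = star I

variable {R K}

/-- `*` is of finite type: `I^* = ⋃ {J^* : J ⊆ I nonzero finitely generated}`. -/
def StarOperation.FiniteType (s : StarOperation R K) : Prop :=
  ∀ I, IsFrac R K I →
    s.star I = ⨆ J ∈ {J : Submodule R K | J ≠ ⊥ ∧ J.FG ∧ J ≤ I}, s.star J

/-- `I` is `*`-stable: with `E := (I^* : I^*)`, one has `(I^*(E : I^*))^* = E`. -/
def StarOperation.Stable (s : StarOperation R K) (I : Submodule R K) : Prop :=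
  s.star (s.star I * ((s.star I / s.star I) / s.star I)) = s.star I / s.star I

/-- `I` is Clifford `*`-regular: `I^* = (I²J)^*` for some nonzero ideal `J`. -/
def StarOperation.Regular (s : StarOperation R K) (I : Submodule R K) : Prop :=
  ∃ J : Submodule R K, IsFrac R K J ∧ s.star I = s.star (I * I * J)

/-- `I` is Boole `*`-regular: `(I²)^* = xI^*` for some nonzero `x ∈ K`. -/
def StarOperation.BooleRegular (s : StarOperation R K) (I : Submodule R K) : Prop :=
  ∃ x : K, x ≠ 0 ∧ s.star (I * I) = x • s.star I

/-- `I` is strongly `*`-stable: `I^* = xE` for some nonzero `x ∈ K`, where `E = (I^* : I^*)`. -/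
def StarOperation.StronglyStable (s : StarOperation R K) (I : Submodule R K) : Prop :=
  ∃ x : K, x ≠ 0 ∧ s.star I = x • (s.star I / s.star I)

end Star

/-- `IR_P`: the `R_P`-submodule of `K` generated by `I`, where `R_P ⊆ K` is the localization
of `R` at `P`; concretely it is generated by the elements `x/s` with `x ∈ I`, `s ∉ P`. -/
def locSub (R K : Type*) [CommRing R] [Field K] [Algebra R K] (P : Ideal R)
    (I : Submodule R K) : Submodule R K :=
  Submodule.span R {z : K | ∃ x ∈ I, ∃ s : R, s ∉ P ∧ z = x * (algebraMap R K s)⁻¹}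

/-- `M` is a `t`-maximal ideal of `R`: an integral `t`-ideal maximal among proper integral
`t`-ideals. -/
def TMaxIdeal (R K : Type*) [CommRing R] [Field K] [Algebra R K] (M : Ideal R) : Prop :=
  M ≠ ⊤ ∧ tS R K (idealK R K M) = idealK R K M ∧
    ∀ J : Ideal R, J ≠ ⊤ → tS R K (idealK R K J) = idealK R K J → M ≤ J → J = M

/-- The `w`-operation: `I^w = ⋂ {IR_M : M a t-maximal ideal of R}`. -/
def wS (R K : Type*) [CommRing R] [Field K] [Algebra R K] (I : Submodule R K) :
    Submodule R K :=
  ⨅ M ∈ {M : Ideal R | TMaxIdeal R K M}, locSub R K M I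


section FractionalIdeals

variable {R K : Type*} [CommRing R] [Field K] [Algebra R K]

theorem mem_idealK {I : Ideal R} {x : K} : x ∈ idealK R K I ↔ ∃ a ∈ I, algebraMap R K a = x :=
  Iff.rfl

theorem idealK_mono {I J : Ideal R} (h : I ≤ J) : idealK R K I ≤ idealK R K J :=
  Submodule.map_mono h

theorem idealK_le_one (I : Ideal R) : idealK R K I ≤ 1 := by
  rintro x ⟨a, -, rfl⟩
  exact Submodule.mem_one.2 ⟨a, rfl⟩

theorem IsFrac.of_le {I J : Submodule R K} (hJ : IsFrac R K J) (hI : I ≠ ⊥) (h : I ≤ J) :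
    IsFrac R K I :=
  ⟨hI, hJ.2.imp fun _ hd => ⟨hd.1, fun x hx => hd.2 x (h hx)⟩⟩

theorem idealK_mul_le (I J : Ideal R) :
    idealK R K I * idealK R K J ≤ idealK R K (I * J) := by
  rw [Submodule.mul_le]
  rintro _ ⟨a, ha, rfl⟩ _ ⟨b, hb, rfl⟩
  exact ⟨a * b, Ideal.mul_mem_mul ha hb, map_mul (algebraMap R K) a b⟩

theorem isFrac_one [IsDomain R] : IsFrac R K (1 : Submodule R K) := by
  refine ⟨fun h => ?_, 1, one_ne_zero, fun x hx => ?_⟩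
  · have h1 : (1 : K) ∈ (1 : Submodule R K) := Submodule.mem_one.2 ⟨1, map_one _⟩
    rw [h] at h1
    exact one_ne_zero ((Submodule.mem_bot R).1 h1)
  · obtain ⟨a, rfl⟩ := Submodule.mem_one.1 hx
    exact ⟨a, by simp⟩

/-- The ideal `(N : x) ∩ R`. -/
def conductorIdeal (N : Submodule R K) (x : K) : Ideal R :=
  N.comap (LinearMap.toSpanSingleton R K x)

theorem mem_conductorIdeal {N : Submodule R K} {x : K} {r : R} :
    r ∈ conductorIdeal N x ↔ algebraMap R K r * x ∈ N := by
  simp [conductorIdeal, Algebra.smul_def]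

variable [IsFractionRing R K]

theorem algebraMap_mem_idealK {I : Ideal R} {a : R} :
    algebraMap R K a ∈ idealK R K I ↔ a ∈ I := by
  refine ⟨?_, fun h => ⟨a, h, rfl⟩⟩
  rintro ⟨b, hb, hba⟩
  exact IsFractionRing.injective R K hba ▸ hb

theorem one_mem_idealK {I : Ideal R} : (1 : K) ∈ idealK R K I ↔ I = ⊤ := by
  rw [← map_one (algebraMap R K), algebraMap_mem_idealK, Ideal.eq_top_iff_one]

theorem idealK_ne_bot {I : Ideal R} : idealK R K I ≠ ⊥ ↔ I ≠ ⊥ :=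
  ((Submodule.map_injective_of_injective (f := Algebra.linearMap R K)
    (IsFractionRing.injective R K)).ne_iff' (Submodule.map_bot _))

/-- A finitely generated submodule of an integral ideal comes from a finitely generated ideal. -/
theorem exists_fg_ideal_of_le_idealK {I : Ideal R} {N : Submodule R K} (hN : N.FG)
    (h : N ≤ idealK R K I) : ∃ J ≤ I, J.FG ∧ idealK R K J = N := by
  have hmap : idealK R K (N.comap (Algebra.linearMap R K)) = N :=
    Submodule.map_comap_eq_of_le (h.trans LinearMap.map_le_range)
  refine ⟨N.comap (Algebra.linearMap R K), fun a ha => ?_, ?_, hmap⟩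
  · exact algebraMap_mem_idealK.1 (h ha)
  · refine Submodule.fg_of_fg_map_injective (Algebra.linearMap R K)
      (IsFractionRing.injective R K) ?_
    exact (congrArg Submodule.FG hmap).mpr hN

variable [IsDomain R]

theorem isFrac_idealK {I : Ideal R} (hI : I ≠ ⊥) : IsFrac R K (idealK R K I) :=
  isFrac_one.of_le (idealK_ne_bot.2 hI) (idealK_le_one I)

theorem conductorIdeal_ne_bot {N : Submodule R K} (hN : N ≠ ⊥) (x : K) :
    conductorIdeal N x ≠ ⊥ := by
  obtain ⟨y, hy, hy0⟩ := N.ne_bot_iff.1 hN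
  obtain ⟨a, b, hb, hab⟩ := IsFractionRing.div_surjective (A := R) y
  obtain ⟨c, d, hd, hcd⟩ := IsFractionRing.div_surjective (A := R) x
  have hb0 : algebraMap R K b ≠ 0 := IsFractionRing.to_map_ne_zero_of_mem_nonZeroDivisors hb
  have hd0 : algebraMap R K d ≠ 0 := IsFractionRing.to_map_ne_zero_of_mem_nonZeroDivisors hd
  have ha0 : a ≠ 0 := by
    rintro rfl
    simp at hab
    exact hy0 hab.symm
  refine (Submodule.ne_bot_iff _).2 ⟨a * d, ?_, mul_ne_zero ha0 (nonZeroDivisors.ne_zero hd)⟩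
  rw [mem_conductorIdeal]
  have : algebraMap R K (a * d) * x = (b * c) • y := by
    rw [Algebra.smul_def, ← hab, ← hcd, map_mul, map_mul]
    field_simp
  rw [this]
  exact N.smul_mem _ hy

end FractionalIdeals

section Radical

variable {R : Type*} [CommRing R] [IsDomain R]

theorem mem_radical_of_mul_mem_sq {I : Ideal R} (hI : I.FG) (hI0 : I ≠ ⊥) {f : R}
    (hf : ∀ a ∈ I, f * a ∈ I * I) : f ∈ I.radical := by
  have : Module.Finite R I := Module.Finite.iff_fg.2 hI
  obtain ⟨p, hp, -, hcoeff, heval⟩ :=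
    LinearMap.exists_monic_and_natDegree_eq_and_coeff_mem_pow_and_aeval_eq_zero R
      (Module.toModuleEnd R I f) I (by
        rintro _ ⟨a, rfl⟩
        have h : ((f • a : I) : R) ∈ I • I := hf a a.2
        have hmap : (I • ⊤ : Submodule R I).map I.subtype = I • I := by
          rw [Submodule.map_smul'', Submodule.map_subtype_top]
        obtain ⟨b, hb, hba⟩ := hmap.ge h
        have : b = f • a := Subtype.ext hba
        rwa [this] at hb)
  obtain ⟨a, ha, ha0⟩ := I.ne_bot_iff.1 hI0
  have hroot : p.eval f = 0 := by
    have h := congrArg (fun g : Module.End R I => ((g ⟨a, ha⟩ : I) : R)) heval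
    have h2 : Polynomial.aeval (Algebra.ofId R (Module.End R I) f) p
        = Algebra.ofId R (Module.End R I) (p.eval f) := by
      rw [Polynomial.aeval_algHom_apply, Polynomial.coe_aeval_eq_eval]
    have h3 : Module.toModuleEnd R I f = Algebra.ofId R (Module.End R I) f := rfl
    rw [h3, h2] at h
    have h4 : p.eval f * a = 0 := h
    exact (mul_eq_zero.1 h4).resolve_right ha0
  refine ⟨p.natDegree, ?_⟩
  rw [Polynomial.eval_eq_sum_range, Finset.sum_range_succ, hp.coeff_natDegree, one_mul] at hroot
  rw [eq_neg_of_add_eq_zero_right hroot]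
  refine I.neg_mem (I.sum_mem fun k hk => I.mul_mem_right _ ?_)
  exact Ideal.pow_le_self (Nat.sub_ne_zero_of_lt (Finset.mem_range.1 hk)) (hcoeff k)

end Radical

section GlazVasconcelos

variable {R : Type*} (K : Type*) [CommRing R] [Field K] [Algebra R K]

/-- `J` is nonzero and `(R : J) = R`. -/
def HasTrivialDual (J : Ideal R) : Prop :=
  J ≠ ⊥ ∧ ∀ u : K, (∀ a ∈ J, algebraMap R K a * u ∈ (1 : Submodule R K)) →
    u ∈ (1 : Submodule R K)

/-- `L` contains a finitely generated ideal with trivial dual (a Glaz–Vasconcelos ideal). -/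
def ContainsGV (L : Ideal R) : Prop :=
  ∃ J ≤ L, J.FG ∧ HasTrivialDual K J

variable {K}

theorem HasTrivialDual.one_mem_vS {J : Ideal R} (hJ : HasTrivialDual K J) :
    (1 : K) ∈ vS R K (idealK R K J) := by
  refine Submodule.mem_div_iff_forall_mul_mem.2 fun u hu => ?_
  rw [one_mul]
  refine hJ.2 u fun a ha => ?_
  rw [mul_comm]
  exact Submodule.mem_div_iff_forall_mul_mem.1 hu _ ⟨a, ha, rfl⟩

theorem HasTrivialDual.top [IsDomain R] : HasTrivialDual K (⊤ : Ideal R) :=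
  ⟨top_ne_bot, fun u hu => by simpa using hu 1 trivial⟩

theorem HasTrivialDual.mul [IsDomain R] {I J : Ideal R} (hI : HasTrivialDual K I)
    (hJ : HasTrivialDual K J) : HasTrivialDual K (I * J) := by
  refine ⟨mul_ne_zero hI.1 hJ.1, fun u hu => hI.2 u fun a ha => hJ.2 _ fun b hb => ?_⟩
  rw [← mul_assoc, ← map_mul, mul_comm b a]
  exact hu _ (Ideal.mul_mem_mul ha hb)

variable (R K) in
theorem isOka_containsGV [IsDomain R] : Ideal.IsOka (ContainsGV K (R := R)) where
  top := ⟨⊤, le_rfl, Ideal.fg_top R, HasTrivialDual.top⟩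
  oka := by
    rintro I a ⟨A, hA, hAfg, hAd⟩ ⟨B, hB, hBfg, hBd⟩
    refine ⟨A * B, (Ideal.mul_mono hA hB).trans ?_, hAfg.mul hBfg, hAd.mul hBd⟩
    rw [Ideal.sup_mul, sup_le_iff]
    refine ⟨Ideal.mul_le.2 fun x hx y _ => I.mul_mem_right y hx, Ideal.mul_le.2 fun x hx b hb => ?_⟩
    obtain ⟨c, rfl⟩ := Ideal.mem_span_singleton'.1 hx
    rw [mul_assoc, mul_comm a b]
    exact I.mul_mem_left _ (Ideal.mem_colon_span_singleton.1 hb)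

theorem exists_le_maximal_not_containsGV {L : Ideal R} (hL : ¬ ContainsGV K L) :
    ∃ M, L ≤ M ∧ Maximal (¬ ContainsGV K ·) M := by
  refine zorn_le_nonempty₀ {I | ¬ ContainsGV K I}
    (fun C hC hchain I hI => ⟨sSup C, ?_, fun _ => le_sSup⟩) L hL
  rintro ⟨J, hJ, hfg, hd⟩
  obtain ⟨I', hI', hle⟩ := (Submodule.fg_iff_compact J).1 hfg
    C _ ⟨I, hI⟩ hchain.directedOn (isLUB_sSup C) hJ
  exact hC hI' ⟨J, hle, hfg, hd⟩

theorem exists_fg_le_sup_span {I A : Ideal R} {r : R} (hA : A.FG) (h : A ≤ I ⊔ Ideal.span {r}) :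
    ∃ B ≤ I, B.FG ∧ A ≤ B ⊔ Ideal.span {r} := by
  classical
  obtain ⟨T, rfl⟩ := hA
  have hT : ∀ t : T, ∃ m ∈ I, ∃ y ∈ Ideal.span {r}, m + y = t := fun t =>
    Submodule.mem_sup.1 (h (Submodule.subset_span t.2))
  choose m hm y hy hmy using hT
  refine ⟨Ideal.span (Set.range m), Ideal.span_le.2 ?_,
    Submodule.fg_span (Set.finite_range m), Submodule.span_le.2 fun t ht => ?_⟩
  · rintro _ ⟨t, rfl⟩
    exact hm t
  · rw [SetLike.mem_coe, ← show m ⟨t, ht⟩ + y ⟨t, ht⟩ = t from hmy ⟨t, ht⟩]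
    exact Submodule.add_mem_sup (Ideal.subset_span ⟨_, rfl⟩) (hy _)

theorem exists_mul_mem_of_mem_locSub {P : Ideal R} (hP : P.IsPrime) {I : Submodule R K} {x : K}
    (hx : x ∈ locSub R K P I) : ∃ r ∉ P, algebraMap R K r * x ∈ I := by
  refine Submodule.span_induction ?_ ?_ ?_ ?_ hx
  · rintro _ ⟨y, hy, r, hr, rfl⟩
    refine ⟨r, hr, ?_⟩
    by_cases h0 : algebraMap R K r = 0
    · simp [h0]
    · rwa [mul_left_comm, mul_inv_cancel₀ h0, mul_one]
  · exact ⟨1, fun h => hP.ne_top ((Ideal.eq_top_iff_one P).2 h), by simp⟩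
  · rintro y z - - ⟨r, hr, hry⟩ ⟨t, ht, htz⟩
    refine ⟨r * t, hP.mul_notMem hr ht, ?_⟩
    have : algebraMap R K (r * t) * (y + z)
        = t • (algebraMap R K r * y) + r • (algebraMap R K t * z) := by
      rw [Algebra.smul_def, Algebra.smul_def, map_mul]; ring
    rw [this]
    exact I.add_mem (I.smul_mem _ hry) (I.smul_mem _ htz)
  · rintro c y - ⟨r, hr, hry⟩
    refine ⟨r, hr, ?_⟩
    rw [mul_smul_comm]
    exact I.smul_mem c hry

variable [IsFractionRing R K]

theorem le_tS {I J : Ideal R} (hJ : J ≠ ⊥) (hfg : J.FG) (h : J ≤ I) :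
    vS R K (idealK R K J) ≤ tS R K (idealK R K I) :=
  le_iSup₂_of_le (idealK R K J) ⟨idealK_ne_bot.2 hJ, Submodule.FG.map _ hfg, idealK_mono h⟩ le_rfl

theorem not_containsGV_of_tS_eq {M : Ideal R} (hM : M ≠ ⊤)
    (ht : tS R K (idealK R K M) = idealK R K M) : ¬ ContainsGV K M := by
  rintro ⟨J, hJ, hfg, hd⟩
  exact hM (one_mem_idealK.1 (ht ▸ le_tS hd.1 hfg hJ hd.one_mem_vS))

theorem vS_idealK_le {M J : Ideal R} (hM : Maximal (¬ ContainsGV K ·) M) (hJ0 : J ≠ ⊥)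
    (hfg : J.FG) (hJM : J ≤ M) : vS R K (idealK R K J) ≤ idealK R K M := by
  intro x hx
  have hx' := Submodule.mem_div_iff_forall_mul_mem.1 hx
  have hx1 : x ∈ (1 : Submodule R K) := by
    rw [← mul_one x]
    refine hx' 1 (Submodule.mem_div_iff_forall_mul_mem.2 fun y hy => ?_)
    rw [one_mul]
    exact idealK_le_one J hy
  obtain ⟨r, rfl⟩ := Submodule.mem_one.1 hx1
  refine algebraMap_mem_idealK.2 (by_contra fun hr => ?_)
  obtain ⟨A, hA, hAfg, hAd⟩ : ContainsGV K (M ⊔ Ideal.span {r}) :=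
    of_not_not (hM.not_prop_of_gt (Submodule.lt_sup_iff_notMem.2 hr))
  obtain ⟨B, hBM, hBfg, hAB⟩ := exists_fg_le_sup_span hAfg hA
  refine hM.prop ⟨B ⊔ J, sup_le hBM hJM, Submodule.FG.sup hBfg hfg,
    fun h => hJ0 (sup_eq_bot_iff.1 h).2, fun u hu => hAd.2 u fun a ha => ?_⟩
  have hur : algebraMap R K r * u ∈ (1 : Submodule R K) := by
    refine hx' u (Submodule.mem_div_iff_forall_mul_mem.2 ?_)
    rintro _ ⟨b, hb, rfl⟩
    rw [mul_comm]
    exact hu b (le_sup_right (a := B) hb)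
  have hle : B ⊔ Ideal.span {r} ≤ conductorIdeal (1 : Submodule R K) u := by
    refine sup_le (fun b hb => mem_conductorIdeal.2 (hu b (le_sup_left (b := J) hb))) ?_
    rw [Ideal.span_singleton_le_iff_mem]
    exact mem_conductorIdeal.2 hur
  exact mem_conductorIdeal.1 (hle (hAB ha))

theorem tMaxIdeal_of_maximal_not_containsGV [IsDomain R] {M : Ideal R} (hM : Maximal (¬ ContainsGV K ·) M) :
    TMaxIdeal R K M := by
  refine ⟨((isOka_containsGV R K).isPrime_of_maximal_not hM).ne_top, le_antisymm ?_ ?_,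
    fun J hJ ht hMJ => ?_⟩
  · refine iSup₂_le fun N hN => ?_
    obtain ⟨J, hJM, hfg, rfl⟩ := exists_fg_ideal_of_le_idealK hN.2.1 hN.2.2
    exact vS_idealK_le hM (idealK_ne_bot.1 hN.1) hfg hJM
  · rintro _ ⟨a, ha, rfl⟩
    by_cases ha0 : a = 0
    · simp [ha0]
    refine le_tS (J := Ideal.span {a}) (by simpa using ha0) ⟨{a}, by simp [Ideal.span]⟩
      ((Ideal.span_singleton_le_iff_mem _).2 ha) ?_
    refine Submodule.mem_div_iff_forall_mul_mem.2 fun u hu => ?_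
    rw [mul_comm]
    exact Submodule.mem_div_iff_forall_mul_mem.1 hu _
      ⟨a, Ideal.mem_span_singleton_self a, rfl⟩
  · exact le_antisymm (hM.2 (not_containsGV_of_tS_eq hJ ht) hMJ) hMJ

end GlazVasconcelos

namespace StarOperation

variable {R K : Type*} [CommRing R] [IsDomain R] [Field K] [Algebra R K] [IsFractionRing R K]
  (s : StarOperation R K)

/-- `L` is a nonzero integral ideal whose star closure is `R`. -/
def StarDense (L : Ideal R) : Prop :=
  L ≠ ⊥ ∧ (1 : K) ∈ s.star (idealK R K L)

variable {s}

theorem StarDense.mono {I L : Ideal R} (hI : s.StarDense I) (h : I ≤ L) : s.StarDense L :=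
  have hL : L ≠ ⊥ := ne_bot_of_le_ne_bot hI.1 h
  ⟨hL, s.star_mono _ _ (isFrac_idealK hI.1) (isFrac_idealK hL) (idealK_mono h) hI.2⟩

theorem StarDense.top : s.StarDense (⊤ : Ideal R) :=
  ⟨top_ne_bot, s.le_star _ (isFrac_idealK top_ne_bot) (one_mem_idealK.2 rfl)⟩

theorem mem_star_of_smul_le {x : K} {L : Ideal R} {N : Submodule R K} (hN : IsFrac R K N)
    (hL : s.StarDense L) (h : ∀ a ∈ L, algebraMap R K a * x ∈ N) : x ∈ s.star N := by
  by_cases hx : x = 0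
  · rw [hx]
    exact Submodule.zero_mem _
  have hle : x • idealK R K L ≤ N := by
    rintro _ ⟨_, ⟨a, ha, rfl⟩, rfl⟩
    have := h a ha
    rwa [mul_comm] at this
  have hne : x • idealK R K L ≠ ⊥ := by
    obtain ⟨a, ha, ha0⟩ := L.ne_bot_iff.1 hL.1
    refine (Submodule.ne_bot_iff _).2 ⟨x * algebraMap R K a,
      Submodule.smul_mem_pointwise_smul _ x _ (algebraMap_mem_idealK.2 ha), mul_ne_zero hx ?_⟩
    exact (map_ne_zero_iff _ (IsFractionRing.injective R K)).2 ha0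
  refine s.star_mono _ _ (hN.of_le hne hle) hN hle ?_
  rw [s.star_smul x hx _ (isFrac_idealK hL.1)]
  simpa using Submodule.smul_mem_pointwise_smul _ x _ hL.2

theorem StarDense.mul {I J : Ideal R} (hI : s.StarDense I) (hJ : s.StarDense J) :
    s.StarDense (I * J) := by
  have hIJ : I * J ≠ ⊥ := mul_ne_zero hI.1 hJ.1
  refine ⟨hIJ, ?_⟩
  have hfrac := isFrac_idealK (K := K) hIJ
  rw [← s.star_star _ hfrac]
  refine mem_star_of_smul_le (s.star_frac _ hfrac) hI fun a ha => ?_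
  rw [mul_one]
  refine mem_star_of_smul_le hfrac hJ fun b hb => ?_
  rw [← map_mul, algebraMap_mem_idealK, mul_comm b a]
  exact Ideal.mul_mem_mul ha hb

theorem StarDense.pow {I : Ideal R} (hI : s.StarDense I) (n : ℕ) : s.StarDense (I ^ n) := by
  induction n with
  | zero => rw [pow_zero, Ideal.one_eq_top]; exact .top
  | succ n ih => rw [pow_succ]; exact ih.mul hI

theorem StarDense.finset_inf {ι : Type*} (T : Finset ι) (f : ι → Ideal R)
    (h : ∀ i ∈ T, s.StarDense (f i)) : s.StarDense (T.inf f) := by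
  classical
  induction T using Finset.induction_on with
  | empty => rw [Finset.inf_empty]; exact .top
  | insert a T _ ih =>
    rw [Finset.inf_insert]
    rw [Finset.forall_mem_insert] at h
    exact (h.1.mul (ih h.2)).mono Ideal.mul_le_inf

theorem StarDense.hasTrivialDual {J : Ideal R} (hJ : s.StarDense J) : HasTrivialDual K J := by
  refine ⟨hJ.1, fun u hu => ?_⟩
  have := mem_star_of_smul_le isFrac_one hJ hu
  rwa [s.star_one] at this

theorem StarDense.exists_fg_le (hft : s.FiniteType) {L : Ideal R} (hL : s.StarDense L) :
    ∃ F ≤ L, F.FG ∧ s.StarDense F := by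
  have hfrac := isFrac_idealK (K := K) hL.1
  have h1 := hL.2
  rw [hft _ hfrac, ← sSup_image] at h1
  have hmem {J : Submodule R K} (hJ : J ≠ ⊥ ∧ J.FG ∧ J ≤ idealK R K L) : IsFrac R K J :=
    hfrac.of_le hJ.1 hJ.2.2
  rw [Submodule.mem_sSup_of_directed] at h1
  · obtain ⟨_, ⟨N, hN, rfl⟩, h1⟩ := h1
    obtain ⟨F, hFL, hfg, rfl⟩ := exists_fg_ideal_of_le_idealK hN.2.1 hN.2.2
    exact ⟨F, hFL, hfg, idealK_ne_bot.1 hN.1, h1⟩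
  · obtain ⟨a, ha, ha0⟩ := L.ne_bot_iff.1 hL.1
    refine ⟨_, idealK R K (Ideal.span {a}), ⟨idealK_ne_bot.2 (by simpa using ha0),
      Submodule.FG.map _ ⟨{a}, by simp [Ideal.span]⟩, idealK_mono ?_⟩, rfl⟩
    exact (Ideal.span_singleton_le_iff_mem _).2 ha
  · rintro _ ⟨A, hA, rfl⟩ _ ⟨B, hB, rfl⟩
    have hAB : A ⊔ B ≠ ⊥ ∧ (A ⊔ B).FG ∧ A ⊔ B ≤ idealK R K L :=
      ⟨ne_bot_of_le_ne_bot hA.1 le_sup_left, hA.2.1.sup hB.2.1, sup_le hA.2.2 hB.2.2⟩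
    exact ⟨_, ⟨A ⊔ B, hAB, rfl⟩, s.star_mono _ _ (hmem hA) (hmem hAB) le_sup_left,
      s.star_mono _ _ (hmem hB) (hmem hAB) le_sup_right⟩

theorem starDense_conductorIdeal
    (hinter : ∀ I J : Submodule R K, IsFrac R K I → IsFrac R K J →
      s.star (I ⊓ J) = s.star I ⊓ s.star J)
    {N : Submodule R K} (hN : IsFrac R K N) {x : K} (hx : x ∈ s.star N) :
    s.StarDense (conductorIdeal N x) := by
  have hne := conductorIdeal_ne_bot hN.1 x
  refine ⟨hne, ?_⟩
  by_cases hx0 : x = 0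
  · have : conductorIdeal N x = ⊤ := by
      rw [Ideal.eq_top_iff_one, mem_conductorIdeal, hx0, mul_zero]
      exact N.zero_mem
    rw [this]
    exact StarDense.top.2
  have hmem {y : K} {P : Submodule R K} : y ∈ x⁻¹ • P ↔ x * y ∈ P := by
    constructor
    · rintro ⟨z, hz, rfl⟩
      simpa [mul_inv_cancel_left₀ hx0] using hz
    · intro h
      simpa [inv_mul_cancel_left₀ hx0] using Submodule.smul_mem_pointwise_smul _ x⁻¹ _ h
  have heq : idealK R K (conductorIdeal N x) = x⁻¹ • N ⊓ 1 := by
    ext y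
    rw [mem_idealK, Submodule.mem_inf, hmem, Submodule.mem_one]
    constructor
    · rintro ⟨a, ha, rfl⟩
      exact ⟨mul_comm x _ ▸ mem_conductorIdeal.1 ha, a, rfl⟩
    · rintro ⟨h, a, rfl⟩
      exact ⟨a, mem_conductorIdeal.2 (mul_comm x _ ▸ h), rfl⟩
  have hfrac : IsFrac R K (x⁻¹ • N) := by
    obtain ⟨d, hd, hdN⟩ := hN.2
    obtain ⟨a, b, hb, hab⟩ := IsFractionRing.div_surjective (A := R) x
    have hb0 : algebraMap R K b ≠ 0 := IsFractionRing.to_map_ne_zero_of_mem_nonZeroDivisors hb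
    refine ⟨fun h => idealK_ne_bot.2 hne (by rw [heq, h, bot_inf_eq]), d * a,
      mul_ne_zero hd ?_, fun y hy => ?_⟩
    · rintro rfl
      simp at hab
      exact hx0 hab.symm
    · obtain ⟨c, hc⟩ := hdN _ (hmem.1 hy)
      refine ⟨b * c, ?_⟩
      rw [map_mul, map_mul, ← hc, ← hab]
      field_simp
  rw [heq, hinter _ _ hfrac isFrac_one, s.star_one, s.star_smul _ (inv_ne_zero hx0) _ hN]
  exact ⟨hmem.2 (by rwa [mul_one]), Submodule.mem_one.2 ⟨1, map_one _⟩⟩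

/-- A regular ideal with trivial dual is star idempotent. -/
theorem idealK_le_star_sq {I : Ideal R} (hI : HasTrivialDual K I)
    (hreg : s.Regular (idealK R K I)) : idealK R K I ≤ s.star (idealK R K (I * I)) := by
  obtain ⟨J, hJ, hIJ⟩ := hreg
  have hI1 := idealK_le_one (K := K) I
  have hIfrac := isFrac_idealK (K := K) hI.1
  have hsq := isFrac_idealK (K := K) (mul_ne_zero hI.1 hI.1)
  have hne : idealK R K I * idealK R K I * J ≠ ⊥ :=
    mul_ne_zero (mul_ne_zero hIfrac.1 hIfrac.1) hJ.1
  have hfrac : IsFrac R K (idealK R K I * idealK R K I * J) := by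
    refine hJ.of_le hne ?_
    calc idealK R K I * idealK R K I * J ≤ 1 * 1 * J := by gcongr
      _ = J := by rw [one_mul, one_mul]
  have hJ1 : J ≤ 1 := by
    intro u hu
    refine hI.2 u fun a ha => hI.2 _ fun b hb => ?_
    rw [← s.star_one]
    refine s.star_mono _ _ hIfrac isFrac_one hI1 ?_
    rw [hIJ]
    refine s.le_star _ hfrac ?_
    rw [← mul_assoc]
    exact Submodule.mul_mem_mul (Submodule.mul_mem_mul ⟨b, hb, rfl⟩ ⟨a, ha, rfl⟩) hu
  refine (s.le_star _ hIfrac).trans (hIJ.trans_le (s.star_mono _ _ hfrac hsq ?_))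
  calc idealK R K I * idealK R K I * J ≤ idealK R K I * idealK R K I * 1 := by gcongr
    _ = idealK R K I * idealK R K I := mul_one _
    _ ≤ _ := idealK_mul_le I I

theorem starDense_of_hasTrivialDual (hft : s.FiniteType)
    (hinter : ∀ I J : Submodule R K, IsFrac R K I → IsFrac R K J →
      s.star (I ⊓ J) = s.star I ⊓ s.star J)
    {I : Ideal R} (hfg : I.FG) (hI : HasTrivialDual K I) (hreg : s.Regular (idealK R K I)) :
    s.StarDense I := by
  obtain ⟨T, hT⟩ := hfg
  have hsq := isFrac_idealK (K := K) (mul_ne_zero hI.1 hI.1)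
  have hdense : s.StarDense
      (T.inf fun t => conductorIdeal (idealK R K (I * I)) (algebraMap R K t)) := by
    refine StarDense.finset_inf _ _ fun t ht => starDense_conductorIdeal hinter hsq ?_
    exact idealK_le_star_sq hI hreg ⟨t, hT ▸ Submodule.subset_span ht, rfl⟩
  obtain ⟨F, hF, hFfg, hFd⟩ := hdense.exists_fg_le hft
  have hrad : F ≤ I.radical := by
    intro f hf
    refine mem_radical_of_mul_mem_sq ⟨T, hT⟩ hI.1 ?_
    suffices I ≤ Submodule.comap (LinearMap.mulLeft R f) (I * I) from fun a ha => this ha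
    conv_lhs => rw [← hT]
    refine Submodule.span_le.2 fun t ht => ?_
    have := mem_conductorIdeal.1 (Finset.inf_le (f := fun t =>
      conductorIdeal (idealK R K (I * I)) (algebraMap R K t)) ht (hF hf))
    rw [← map_mul (algebraMap R K)] at this
    exact (algebraMap_mem_idealK (K := K) (I := I * I)).1 this
  obtain ⟨n, hn⟩ := Ideal.exists_pow_le_of_le_radical_of_fg hrad hFfg
  exact (hFd.pow n).mono hn

end StarOperation


/-- Let `R` be a domain which is not a field and let `*` be a star operation
on `R` which is spectral and of finite type (i.e. of finite type and distributing over finite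
intersections). If `R` is Clifford `*`-regular, then `*` is the `w`-operation. -/
theorem star_eq_w_of_clifford_regular
    {R K : Type*} [CommRing R] [IsDomain R] [Field K] [Algebra R K] [IsFractionRing R K]
    (hnf : ¬ IsField R)
    (s : StarOperation R K) (hft : s.FiniteType)
    (hinter : ∀ I J : Submodule R K, IsFrac R K I → IsFrac R K J →
      s.star (I ⊓ J) = s.star I ⊓ s.star J)
    (hreg : ∀ I : Submodule R K, IsFrac R K I → s.Regular I) :
    ∀ I : Submodule R K, IsFrac R K I → s.star I = wS R K I := by
  intro I hI
  refine le_antisymm (fun x hx => ?_) fun x hx => ?_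
  · refine Submodule.mem_iInf _ |>.2 fun M => Submodule.mem_iInf _ |>.2 fun hM => ?_
    obtain ⟨F, hF, hfg, hFd⟩ :=
      (StarOperation.starDense_conductorIdeal hinter hI hx).exists_fg_le hft
    have hFM : ¬ F ≤ M := fun h =>
      not_containsGV_of_tS_eq hM.1 hM.2.1 ⟨F, h, hfg, hFd.hasTrivialDual⟩
    obtain ⟨r, hrF, hrM⟩ := SetLike.not_le_iff_exists.1 hFM
    refine Submodule.subset_span ⟨_, mem_conductorIdeal.1 (hF hrF), r, hrM, ?_⟩
    have hr0 : algebraMap R K r ≠ 0 :=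
      (map_ne_zero_iff _ (IsFractionRing.injective R K)).2 fun h => hrM (h ▸ M.zero_mem)
    field_simp
  · by_cases hL : ContainsGV K (conductorIdeal I x)
    · obtain ⟨J, hJ, hfg, hd⟩ := hL
      refine StarOperation.mem_star_of_smul_le hI
        (StarOperation.starDense_of_hasTrivialDual hft hinter hfg hd
          (hreg _ (isFrac_idealK hd.1))) fun a ha => mem_conductorIdeal.1 (hJ ha)
    · obtain ⟨M, hLM, hM⟩ := exists_le_maximal_not_containsGV hL
      have hxM := (Submodule.mem_iInf _).1 ((Submodule.mem_iInf _).1 hx M)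
        (tMaxIdeal_of_maximal_not_containsGV hM)
      obtain ⟨r, hrM, hr⟩ := exists_mul_mem_of_mem_locSub
        ((isOka_containsGV R K).isPrime_of_maximal_not hM) hxM
      exact absurd (hLM (mem_conductorIdeal.2 hr)) hrM
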